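/- arXiv:1901.10604 — 9 statements merged into one kernel-verified Lean document; each statement's English description precedes it below -/
import Mathlib

section
/- Let H be a real inner product space and let K ⊆ H be a convex set contained in the closed unit ball of H. Let m be a point of the closed unit ball, let p ∈ K satisfy ⟨m − p, z − p⟩ ≤ 0 for all z ∈ K (so p is the projection of m onto K), and let q ∈ K and q₀ be any point of the closed unit ball. Then ‖p − m‖² ≤ ‖m − q₀‖² − ‖p − q‖² + 6‖q₀ − q‖. -/
open scoped RealInnerProductSpace

/-- **Per-step inequality in the proof of Theorem 4.**
If `p` is the projection of a unit-ball point `m` onto a convex set `K` contained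
in the closed unit ball, then for any `q ∈ K` and any unit-ball point `q₀`,
`‖p − m‖² ≤ ‖m − q₀‖² − ‖p − q‖² + 6‖q₀ − q‖`. -/
theorem projection_per_step_inequality
    {H : Type*} [NormedAddCommGroup H] [InnerProductSpace ℝ H]
    (K : Set H) (hconv : Convex ℝ K) (hball : ∀ z ∈ K, ‖z‖ ≤ 1)
    (m p q q₀ : H) (hm : ‖m‖ ≤ 1) (hq₀ : ‖q₀‖ ≤ 1)
    (hp : p ∈ K) (hq : q ∈ K)
    (hproj : ∀ z ∈ K, ⟪m - p, z - p⟫ ≤ 0) :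
    ‖p - m‖ ^ 2 ≤ ‖m - q₀‖ ^ 2 - ‖p - q‖ ^ 2 + 6 * ‖q₀ - q‖ := by
  have pythagorean : ‖p - m‖ ^ 2 + ‖p - q‖ ^ 2 ≤ ‖m - q‖ ^ 2 := by
    have expand := norm_sub_sq_real (m - p) (q - p)
    rw [sub_sub_sub_cancel_right] at expand
    rw [norm_sub_rev p m, norm_sub_rev p q]
    linarith [hproj q hq]
  have triangle : ‖m - q‖ ≤ ‖m - q₀‖ + ‖q₀ - q‖ := norm_sub_le_norm_sub_add_norm_sub m q₀ q
  have hmq : ‖m - q‖ ≤ 2 := by linarith [norm_sub_le m q, hball q hq]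
  have hmq₀ : ‖m - q₀‖ ≤ 2 := by linarith [norm_sub_le m q₀]
  have sq_diff : ‖m - q‖ ^ 2 - ‖m - q₀‖ ^ 2 ≤ 6 * ‖q₀ - q‖ := by
    calc ‖m - q‖ ^ 2 - ‖m - q₀‖ ^ 2
        = (‖m - q‖ - ‖m - q₀‖) * (‖m - q‖ + ‖m - q₀‖) := by ring
      _ ≤ ‖q₀ - q‖ * 6 := by
        gcongr <;> linarith
      _ = 6 * ‖q₀ - q‖ := mul_comm _ _
  linarith
end

section
/- Fix an integer K ≥ 2 and a real η with 0 < η ≤ 1/162. Let b₁, b₂ ∈ ℝ^K be arbitrary and let a₀ ∈ Δ_K have all coordinates positive. Suppose a₁ ∈ Δ_K has all coordinates positive and minimizes F₁(a) = ⟨a, b₁⟩ + D_ψ(a, a₀) over all a ∈ Δ_K with positive coordinates, and a₂ ∈ Δ_K has all coordinates positive and minimizes F₂(a) = ⟨a, b₂⟩ + D_ψ(a, a₀) over all a ∈ Δ_K with positive coordinates. If ‖b₁ − b₂‖_{∇⁻²ψ(a₁)} ≤ 1/9, then for every i ∈ {1,…,K}, max{a_{2,i}/a_{1,i}, a_{1,i}/a_{2,i}}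 ≤ 27/26. -/
open Finset

/-- The probability simplex over `K` arms, restricted to strictly positive coordinates. -/
def posSimplex (K : ℕ) (x : Fin K → ℝ) : Prop :=
  (∀ i, 0 < x i) ∧ ∑ i, x i = 1

/-- The hybrid regularizer `ψ(x) = (1/η)·∑ᵢ ln(1/xᵢ) + (K/η)·∑ᵢ xᵢ ln xᵢ`. -/
noncomputable def hybridPsi (K : ℕ) (η : ℝ) (x : Fin K → ℝ) : ℝ :=
  (1 / η) * ∑ i, Real.log (1 / x i) + ((K : ℝ) / η) * ∑ i, x i * Real.log (x i)

/-- The gradient of the hybrid regularizer. -/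
noncomputable def hybridGradPsi (K : ℕ) (η : ℝ) (y : Fin K → ℝ) (i : Fin K) : ℝ :=
  (1 / η) * (-(1 / y i)) + ((K : ℝ) / η) * (Real.log (y i) + 1)

/-- The Bregman divergence `D_ψ(x, y) = ψ(x) − ψ(y) − ⟨∇ψ(y), x − y⟩` of the
hybrid regularizer. -/
noncomputable def hybridBreg (K : ℕ) (η : ℝ) (x y : Fin K → ℝ) : ℝ :=
  hybridPsi K η x - hybridPsi K η y - ∑ i, hybridGradPsi K η y i * (x i - y i)

/-- The `i`-th diagonal entry `hᵢ(x) = (1/η)(1/xᵢ² + K/xᵢ)` of the Hessian `∇²ψ(x)`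
of the hybrid regularizer. -/
noncomputable def hybridHess (K : ℕ) (η : ℝ) (x : Fin K → ℝ) (i : Fin K) : ℝ :=
  (1 / η) * (1 / (x i) ^ 2 + (K : ℝ) / x i)

/-- Squared local norm `‖v‖²_{∇²ψ(x)} = ∑ᵢ hᵢ(x)·vᵢ²`. -/
noncomputable def hessNormSq (K : ℕ) (η : ℝ) (x v : Fin K → ℝ) : ℝ :=
  ∑ i, hybridHess K η x i * (v i) ^ 2

/-- Squared dual local norm `‖v‖²_{∇⁻²ψ(x)} = ∑ᵢ vᵢ²/hᵢ(x)`. -/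
noncomputable def invHessNormSq (K : ℕ) (η : ℝ) (x v : Fin K → ℝ) : ℝ :=
  ∑ i, (v i) ^ 2 / hybridHess K η x i

/-- The importance-weighted optimistic estimator `ℓ̂` built from loss `ℓ`, optimistic
prediction `m`, played arm `j`, and sampling distribution `w`:
`ℓ̂ⱼ = (ℓⱼ − mⱼ)/wⱼ + mⱼ` and `ℓ̂ᵢ = mᵢ` for `i ≠ j`. -/
noncomputable def iwEstimator (K : ℕ) (ℓ m : Fin K → ℝ) (j : Fin K) (w : Fin K → ℝ)
    (i : Fin K) : ℝ :=
  if i = j then (ℓ j - m j) / w j + m j else m i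

/-- First-order optimality: a mirror-descent step has zero derivative in every direction
pointing to another point of the open simplex. -/
lemma posSimplex_minimizer_first_order (K : ℕ) (η : ℝ) (b a₀ a c : Fin K → ℝ)
    (ha : posSimplex K a) (hc : posSimplex K c)
    (hmin : ∀ x, posSimplex K x →
      (∑ i, a i * b i) + hybridBreg K η a a₀ ≤ (∑ i, x i * b i) + hybridBreg K η x a₀) :
    ∑ i, (c i - a i) * (b i + hybridGradPsi K η a i - hybridGradPsi K η a₀ i) = 0 := by
  set p : ℝ → Fin K → ℝ := fun t i => a i + t * (c i - a i) with hp
  have hp0 : p 0 = a := by ext i; simp [hp]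
  have hpd : ∀ i, HasDerivAt (fun t => p t i) (c i - a i) 0 := fun i => by
    simpa [hp] using ((hasDerivAt_id (0 : ℝ)).mul_const (c i - a i)).const_add (a i)
  have hpos : ∀ᶠ t in nhds (0 : ℝ), ∀ i, 0 < p t i := by
    refine Filter.eventually_all.2 fun i => ?_
    refine (hpd i).continuousAt.eventually (lt_mem_nhds ?_)
    simpa [hp0] using ha.1 i
  have hloc : IsLocalMin (fun t => (∑ i, p t i * b i) + hybridBreg K η (p t) a₀) 0 := by
    filter_upwards [hpos] with t ht
    have hsum : ∑ i, p t i = 1 := by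
      simp [hp, Finset.sum_add_distrib, ← Finset.mul_sum, ha.2, hc.2]
    simpa only [hp0] using hmin (p t) ⟨ht, hsum⟩
  have hlog : ∀ i, HasDerivAt (fun t => Real.log (p t i)) ((c i - a i) / a i) 0 := fun i => by
    have h := (hpd i).log (by rw [hp0]; exact (ha.1 i).ne')
    rwa [hp0] at h
  have hinv : ∀ i, HasDerivAt (fun t => Real.log (1 / p t i)) (-((c i - a i) / a i)) 0 :=
    fun i => by simpa only [one_div, Real.log_inv] using (hlog i).fun_neg
  have hder : HasDerivAt (fun t => (∑ i, p t i * b i) + hybridBreg K η (p t) a₀)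
      ((∑ i, (c i - a i) * b i) + ((1 / η) * ∑ i, -((c i - a i) / a i)
        + ((K : ℝ) / η) * ∑ i, ((c i - a i) * Real.log (a i) + a i * ((c i - a i) / a i))
        - ∑ i, hybridGradPsi K η a₀ i * (c i - a i))) 0 := by
    unfold hybridBreg hybridPsi
    refine (HasDerivAt.fun_sum fun i _ => (hpd i).mul_const (b i)).add
      (((((HasDerivAt.fun_sum fun i _ => hinv i).const_mul (1 / η)).add
        ((HasDerivAt.fun_sum fun i _ => ?_).const_mul ((K : ℝ) / η))).sub_const _).sub
        (HasDerivAt.fun_sum fun i _ => ((hpd i).sub_const (a₀ i)).const_mul _))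
    simpa only [hp0] using (hpd i).fun_mul (hlog i)
  rw [← hloc.hasDerivAt_eq_zero hder, Finset.mul_sum, Finset.mul_sum, ← Finset.sum_add_distrib,
    ← Finset.sum_sub_distrib, ← Finset.sum_add_distrib]
  refine Finset.sum_congr rfl fun i _ => ?_
  have hi := (ha.1 i).ne'
  rw [mul_div_cancel₀ _ hi, hybridGradPsi]
  ring

/-- Secant lower bound for the logarithm when `y ≤ R * x`. -/
lemma sq_sub_div_le_log_sub_mul {x y R : ℝ} (hx : 0 < x) (hy : 0 < y) (hR : 1 ≤ R)
    (hyR : y ≤ R * x) :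
    (y - x) ^ 2 / (R * x) ≤ (Real.log y - Real.log x) * (y - x) := by
  have hRx : 0 < R * x := by positivity
  rcases le_total x y with h | h
  · have h1 : (y - x) / y ≤ Real.log y - Real.log x := by
      have := Real.one_sub_inv_le_log_of_pos (div_pos hy hx)
      rw [Real.log_div hy.ne' hx.ne', inv_div] at this
      rwa [sub_div, div_self hy.ne']
    have h2 : (y - x) / (R * x) ≤ (y - x) / y :=
      div_le_div_of_nonneg_left (sub_nonneg.2 h) hy hyR
    calc (y - x) ^ 2 / (R * x) = (y - x) / (R * x) * (y - x) := by ring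
      _ ≤ _ := mul_le_mul_of_nonneg_right (h2.trans h1) (sub_nonneg.2 h)
  · have h1 : (x - y) / x ≤ Real.log x - Real.log y := by
      have := Real.one_sub_inv_le_log_of_pos (div_pos hx hy)
      rw [Real.log_div hx.ne' hy.ne', inv_div] at this
      rwa [sub_div, div_self hx.ne']
    have h2 : (x - y) / (R * x) ≤ (x - y) / x :=
      div_le_div_of_nonneg_left (sub_nonneg.2 h) hx (le_mul_of_one_le_left hx.le hR)
    calc (y - x) ^ 2 / (R * x) = (x - y) / (R * x) * (x - y) := by ring
      _ ≤ (Real.log x - Real.log y) * (x - y) :=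
        mul_le_mul_of_nonneg_right (h2.trans h1) (sub_nonneg.2 h)
      _ = _ := by ring

/-- Coordinatewise strong monotonicity of the gradient of the hybrid regularizer. -/
lemma hybridHess_mul_sq_div_le (K : ℕ) {η : ℝ} (hη : 0 < η) {x y : Fin K → ℝ} {R : ℝ}
    (i : Fin K) (hx : 0 < x i) (hy : 0 < y i) (hR : 1 ≤ R) (hyR : y i ≤ R * x i) :
    hybridHess K η x i * (y i - x i) ^ 2 / R ≤
      (hybridGradPsi K η y i - hybridGradPsi K η x i) * (y i - x i) := by
  have hlog := sq_sub_div_le_log_sub_mul hx hy hR hyR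
  have hR0 : 0 < R := by linarith
  have hrec : (y i - x i) ^ 2 / (R * x i * x i) ≤ (y i - x i) ^ 2 / (y i * x i) :=
    div_le_div_of_nonneg_left (sq_nonneg _) (by positivity)
      (mul_le_mul_of_nonneg_right hyR hx.le)
  have hK : (0 : ℝ) ≤ K := K.cast_nonneg
  calc hybridHess K η x i * (y i - x i) ^ 2 / R
      = (1 / η) * ((y i - x i) ^ 2 / (R * x i * x i) + K * ((y i - x i) ^ 2 / (R * x i))) := by
        unfold hybridHess
        field_simp
    _ ≤ (1 / η) * ((y i - x i) ^ 2 / (y i * x i)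
          + K * ((Real.log (y i) - Real.log (x i)) * (y i - x i))) := by gcongr
    _ = _ := by
        unfold hybridGradPsi
        field_simp
        ring

lemma hybridHess_pos (K : ℕ) {η : ℝ} (hη : 0 < η) {x : Fin K → ℝ} (i : Fin K)
    (hx : 0 < x i) : 0 < hybridHess K η x i := by
  unfold hybridHess
  positivity

/-- Cauchy–Schwarz for the local norm and its dual. -/
lemma sq_sum_mul_le_invHessNormSq_mul_hessNormSq (K : ℕ) {η : ℝ} (hη : 0 < η)
    {x : Fin K → ℝ} (hx : ∀ i, 0 < x i) (u v : Fin K → ℝ) :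
    (∑ i, u i * v i) ^ 2 ≤ invHessNormSq K η x u * hessNormSq K η x v := by
  refine Finset.sum_sq_le_sum_mul_sum_of_sq_le_mul _ (fun i _ => ?_) (fun i _ => ?_)
    (fun i _ => ?_)
  · have := hybridHess_pos K hη i (hx i)
    positivity
  · have := hybridHess_pos K hη i (hx i)
    positivity
  · have := (hybridHess_pos K hη i (hx i)).ne'
    refine le_of_eq ?_
    field_simp

/-- The local norm controls every relative deviation. -/
lemma sq_div_sub_one_le_mul_hessNormSq (K : ℕ) {η : ℝ} (hη : 0 < η) {x : Fin K → ℝ}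
    (hx : ∀ i, 0 < x i) (y : Fin K → ℝ) (i : Fin K) :
    (y i / x i - 1) ^ 2 ≤ η * hessNormSq K η x (fun j => y j - x j) := by
  have hi := hx i
  have hsingle : hybridHess K η x i * (y i - x i) ^ 2 ≤
      hessNormSq K η x (fun j => y j - x j) :=
    Finset.single_le_sum (f := fun j => hybridHess K η x j * (y j - x j) ^ 2)
      (fun j _ => mul_nonneg (hybridHess_pos K hη j (hx j)).le (sq_nonneg _))
      (Finset.mem_univ i)
  calc (y i / x i - 1) ^ 2 = 1 / x i ^ 2 * (y i - x i) ^ 2 := by field_simp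
    _ ≤ (1 / x i ^ 2 + (K : ℝ) / x i) * (y i - x i) ^ 2 := by
        gcongr
        exact le_add_of_nonneg_right (by positivity)
    _ = η * (hybridHess K η x i * (y i - x i) ^ 2) := by
        unfold hybridHess
        field_simp
    _ ≤ _ := by gcongr

/-- **Auxiliary stability lemma (Lemma 2 of the paper).**
If two mirror-descent steps from the same point `a₀` use loss vectors `b₁, b₂` whose
difference is small in the inverse-Hessian local norm at `a₁`, then the two resulting
points `a₁, a₂` are within a `27/26` multiplicative factor coordinatewise. -/
theorem auxiliary_stability
    (K : ℕ) (hK : 2 ≤ K) (η : ℝ) (hη : 0 < η) (hη' : η ≤ 1 / 162)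
    (b₁ b₂ : Fin K → ℝ) (a₀ a₁ a₂ : Fin K → ℝ)
    (ha₀ : posSimplex K a₀) (ha₁ : posSimplex K a₁) (ha₂ : posSimplex K a₂)
    (hmin₁ : ∀ a, posSimplex K a →
      (∑ i, a₁ i * b₁ i) + hybridBreg K η a₁ a₀ ≤ (∑ i, a i * b₁ i) + hybridBreg K η a a₀)
    (hmin₂ : ∀ a, posSimplex K a →
      (∑ i, a₂ i * b₂ i) + hybridBreg K η a₂ a₀ ≤ (∑ i, a i * b₂ i) + hybridBreg K η a a₀)
    (hnorm : Real.sqrt (invHessNormSq K η a₁ (fun i => b₁ i - b₂ i)) ≤ 1 / 9) :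
    ∀ i, max (a₂ i / a₁ i) (a₁ i / a₂ i) ≤ 27 / 26 := by
  have hL : ∑ i, (hybridGradPsi K η a₂ i - hybridGradPsi K η a₁ i) * (a₂ i - a₁ i) =
      ∑ i, (b₁ i - b₂ i) * (a₂ i - a₁ i) := by
    have h1 := posSimplex_minimizer_first_order K η b₁ a₀ a₁ a₂ ha₁ ha₂ hmin₁
    have h2 := posSimplex_minimizer_first_order K η b₂ a₀ a₂ a₁ ha₂ ha₁ hmin₂
    rw [← sub_eq_zero, ← neg_eq_zero, ← add_zero (0 : ℝ)]
    nth_rewrite 1 [← h1]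
    rw [← h2, ← Finset.sum_sub_distrib, ← Finset.sum_neg_distrib, ← Finset.sum_add_distrib]
    exact Finset.sum_congr rfl fun i _ => by ring
  set N := hessNormSq K η a₁ (fun j => a₂ j - a₁ j) with hN
  have hN0 : 0 ≤ N := Finset.sum_nonneg fun i _ =>
    mul_nonneg (hybridHess_pos K hη i (ha₁.1 i)).le (sq_nonneg _)
  have hinv : invHessNormSq K η a₁ (fun i => b₁ i - b₂ i) ≤ 1 / 81 := by
    have := (Real.sqrt_le_left (by norm_num)).1 hnorm
    norm_num at this ⊢
    exact this
  have hCS := sq_sum_mul_le_invHessNormSq_mul_hessNormSq K hη ha₁.1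
    (fun i => b₁ i - b₂ i) (fun i => a₂ i - a₁ i)
  have : NeZero K := ⟨by omega⟩
  obtain ⟨m, hm⟩ := Finite.exists_max fun i => a₂ i / a₁ i
  set R := max 1 (a₂ m / a₁ m) with hRdef
  have hR1 : 1 ≤ R := le_max_left _ _
  have hmono : N / R ≤ ∑ i, (b₁ i - b₂ i) * (a₂ i - a₁ i) := by
    rw [← hL, hN, hessNormSq, Finset.sum_div]
    refine Finset.sum_le_sum fun i _ =>
      hybridHess_mul_sq_div_le K hη i (ha₁.1 i) (ha₂.1 i) hR1 ?_
    exact (div_le_iff₀ (ha₁.1 i)).1 ((hm i).trans (le_max_right _ _))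
  have hNR : N ≤ R ^ 2 / 81 := by
    have hsq : (N / R) ^ 2 ≤ 1 / 81 * N :=
      (pow_le_pow_left₀ (by positivity) hmono 2).trans
        (hCS.trans (mul_le_mul_of_nonneg_right hinv hN0))
    rw [div_pow, div_le_iff₀ (by positivity)] at hsq
    by_contra! hlt
    have hpos : 0 < N := lt_of_le_of_lt (by positivity) hlt
    nlinarith
  have hdev : ∀ i, |a₂ i / a₁ i - 1| ≤ R / 114 := fun i => by
    refine abs_le_of_sq_le_sq ?_ (by positivity)
    have h := sq_div_sub_one_le_mul_hessNormSq K hη ha₁.1 a₂ i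
    have h' : η * N ≤ 1 / 162 * (R ^ 2 / 81) := by gcongr
    nlinarith [sq_nonneg R]
  have hR2 : R ≤ 114 / 113 := by
    have := (abs_le.1 (hdev m)).2
    rcases max_choice 1 (a₂ m / a₁ m) with h | h <;> rw [← hRdef] at h <;> linarith
  intro i
  obtain ⟨hlo, hhi⟩ := abs_le.1 (hdev i)
  refine max_le (by linarith) ?_
  rw [← inv_div]
  exact inv_le_of_inv_le₀ (by norm_num) (by norm_num; linarith)
end

section
/- Fix integers K ≥ 2 and reals η with 0 < η ≤ min{1/K, 1/162}; set α = 8η. Let x' ∈ Δ_K have all coordinates positive, let m, m⁺, ℓ ∈ [0,1]^K, let j ∈ {1,…,K}, and let w ∈ Δ_K have all coordinates positive. Suppose: (a) x ∈ Δ_K has all coordinates positive and minimizes ⟨·, m⟩ + D_ψ(·, x') over Δ_K points with positive coordinates; (b) x_i ≤ w_i/(1−α) for all i; (c) x'⁺ ∈ Δ_K has all coordinates positive and minimizes ⟨·, ℓ̂⟩ + D_ψ(·, x') over Δ_K points with positive coordinates, where ℓ̂ is the importance-weighted optimistic estimator built from ℓ, m, j, w; (d) x⁺ ∈ Δ_K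 has all coordinates positive and minimizes ⟨·, m⁺⟩ + D_ψ(·, x'⁺) over Δ_K points with positive coordinates. Then for every i ∈ {1,…,K}, max{x⁺_i/x_i, x_i/x⁺_i} ≤ 2. -/
open Finset

/-- Derivative at `0` of the mirror descent objective along the line `x + t v`. -/
theorem hasDerivAt_hybridObjective {K : ℕ} {η : ℝ} {x : Fin K → ℝ} (hx : ∀ i, 0 < x i)
    (c u v : Fin K → ℝ) :
    HasDerivAt (fun t : ℝ => (∑ i, (x i + t * v i) * c i) +
        hybridBreg K η (fun i => x i + t * v i) u)
      (∑ i, v i * (c i + hybridGradPsi K η x i - hybridGradPsi K η u i)) 0 := by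
  have hline (i : Fin K) : HasDerivAt (fun t : ℝ => x i + t * v i) (v i) 0 := by
    simpa using ((hasDerivAt_id (0 : ℝ)).mul_const (v i)).const_add (x i)
  have hlog (i : Fin K) : HasDerivAt (fun t : ℝ => Real.log (x i + t * v i)) (v i / x i) 0 := by
    simpa using (hline i).log (by simpa using (hx i).ne')
  have hlin : HasDerivAt (fun t : ℝ => ∑ i, (x i + t * v i) * c i) (∑ i, v i * c i) 0 :=
    HasDerivAt.fun_sum fun i _ => (hline i).mul_const (c i)
  have hbarrier : HasDerivAt (fun t : ℝ => ∑ i, Real.log (1 / (x i + t * v i)))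
      (∑ i, -(v i / x i)) 0 := by
    simp only [one_div, Real.log_inv]
    exact HasDerivAt.fun_sum fun i _ => (hlog i).neg
  have hentropy : HasDerivAt (fun t : ℝ => ∑ i, (x i + t * v i) * Real.log (x i + t * v i))
      (∑ i, (v i * Real.log (x i) + v i)) 0 := by
    refine HasDerivAt.fun_sum fun i _ => ?_
    have h := (hline i).mul (hlog i)
    simp only [zero_mul, add_zero] at h
    rwa [mul_div_cancel₀ _ (hx i).ne'] at h
  have hgrad : HasDerivAt (fun t : ℝ => ∑ i, hybridGradPsi K η u i * (x i + t * v i - u i))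
      (∑ i, hybridGradPsi K η u i * v i) 0 :=
    HasDerivAt.fun_sum fun i _ => ((hline i).sub_const (u i)).const_mul _
  have h := hlin.add (((((hbarrier.const_mul (1 / η)).add
    (hentropy.const_mul ((K : ℝ) / η))).sub_const (hybridPsi K η u))).sub hgrad)
  refine h.congr_deriv ?_
  simp only [Finset.mul_sum, ← Finset.sum_add_distrib, ← Finset.sum_sub_distrib]
  refine Finset.sum_congr rfl fun i _ => ?_
  simp only [hybridGradPsi]
  ring

/-- First-order optimality of a mirror descent step in the open simplex: the gradient of the
objective has equal coordinates at a minimizer. -/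
theorem hybridObjective_grad_eq_of_min {K : ℕ} {η : ℝ} {x c u : Fin K → ℝ} (hx : posSimplex K x)
    (hmin : ∀ z, posSimplex K z →
      (∑ i, x i * c i) + hybridBreg K η x u ≤ (∑ i, z i * c i) + hybridBreg K η z u)
    (i k : Fin K) :
    c i + hybridGradPsi K η x i - hybridGradPsi K η u i =
      c k + hybridGradPsi K η x k - hybridGradPsi K η u k := by
  set v : Fin K → ℝ := Pi.single i 1 - Pi.single k 1 with hv
  have hpos : ∀ᶠ t : ℝ in nhds 0, ∀ l, 0 < x l + t * v l := by
    refine Filter.eventually_all.2 fun l => ?_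
    have hcont : ContinuousAt (fun t : ℝ => x l + t * v l) 0 := by fun_prop
    exact hcont.eventually (lt_mem_nhds (by simpa using hx.1 l))
  have hloc : IsLocalMin (fun t : ℝ => (∑ i, (x i + t * v i) * c i) +
      hybridBreg K η (fun i => x i + t * v i) u) 0 := by
    filter_upwards [hpos] with t ht
    have hsum : ∑ l, (x l + t * v l) = 1 := by
      simp [Finset.sum_add_distrib, ← Finset.mul_sum, hx.2, hv]
    simpa using hmin _ ⟨ht, hsum⟩
  have h := hloc.hasDerivAt_eq_zero (hasDerivAt_hybridObjective hx.1 c u v)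
  simp only [hv, Pi.sub_apply, sub_mul, Finset.sum_sub_distrib, Pi.single_apply, ite_mul, one_mul,
    zero_mul, Finset.sum_ite_eq', Finset.mem_univ, if_true] at h
  linarith

/-- The scaled one-coordinate gradient increment `φ(b) - φ(a)` of the hybrid regularizer,
with `φ(t) = -1/t + κ ln t`. -/
noncomputable def hybridIncrement (κ a b : ℝ) : ℝ :=
  1 / a - 1 / b + κ * (Real.log b - Real.log a)

theorem hybridIncrement_nonneg {κ a b : ℝ} (hκ : 0 ≤ κ) (ha : 0 < a) (hab : a ≤ b) :
    0 ≤ hybridIncrement κ a b := by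
  have h1 := one_div_le_one_div_of_le ha hab
  have h2 := mul_nonneg hκ (sub_nonneg.2 (Real.log_le_log ha hab))
  unfold hybridIncrement
  linarith

theorem hybridIncrement_swap (κ a b : ℝ) : hybridIncrement κ b a = -hybridIncrement κ a b := by
  unfold hybridIncrement
  ring

theorem lt_of_hybridIncrement_pos {κ a b : ℝ} (hκ : 0 ≤ κ) (hb : 0 < b)
    (h : 0 < hybridIncrement κ a b) : a < b := by
  by_contra! hba
  have := hybridIncrement_nonneg hκ hb hba
  rw [hybridIncrement_swap] at this
  linarith

theorem half_inv_le_hybridIncrement {κ a b : ℝ} (hκ : 0 ≤ κ) (ha : 0 < a) (hab : 2 * a ≤ b) :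
    1 / a / 2 ≤ hybridIncrement κ a b := by
  have h1 := one_div_le_one_div_of_le (by positivity) hab
  have h2 := mul_nonneg hκ (sub_nonneg.2 (Real.log_le_log ha (by linarith : a ≤ b)))
  have h3 : 1 / (2 * a) = 1 / a / 2 := by field_simp
  unfold hybridIncrement
  linarith

/-- If the gradient of the hybrid regularizer moves, up to a common shift, by at most `B` in every
coordinate except `j` and by at most `B / x j` in coordinate `j`, then the point of the simplex
moves by at most a factor `2` in each coordinate. -/
theorem le_two_mul_of_hybridIncrement {K : ℕ} {κ B C : ℝ} {x y d : Fin K → ℝ} {j : Fin K}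
    (hκ : 0 ≤ κ) (hB : 0 < B) (hB' : B ≤ 1 / 16) (hx : posSimplex K x) (hy : posSimplex K y)
    (hinc : ∀ i, hybridIncrement κ (x i) (y i) = C - d i)
    (hd : ∀ i, i ≠ j → |d i| ≤ B) (hdj : |d j| ≤ B * (1 / x j)) (i : Fin K) :
    y i ≤ 2 * x i ∧ x i ≤ 2 * y i := by
  obtain ⟨hx0, hxs⟩ := hx
  obtain ⟨hy0, hys⟩ := hy
  have hinv (k : Fin K) : 1 ≤ 1 / x k := by
    rw [le_div_iff₀ (hx0 k), one_mul, ← hxs]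
    exact Finset.single_le_sum (fun l _ => (hx0 l).le) (Finset.mem_univ k)
  have hBj : B ≤ B * (1 / x j) := le_mul_of_one_le_right hB.le (hinv j)
  have hd' (k : Fin K) : |d k| ≤ B * (1 / x j) := by
    by_cases hk : k = j
    · exact hk ▸ hdj
    · exact (hd k hk).trans hBj
  have hup (k : Fin K) (h : d k < C) : x k < y k :=
    lt_of_hybridIncrement_pos hκ (hy0 k) (by rw [hinc]; linarith)
  have hdown (k : Fin K) (h : C < d k) : y k < x k :=
    lt_of_hybridIncrement_pos hκ (hx0 k) (by rw [hybridIncrement_swap, hinc]; linarith)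
  have hCle : C ≤ B * (1 / x j) := by
    by_contra! h
    have := Finset.sum_lt_sum_of_nonempty (s := Finset.univ) ⟨j, Finset.mem_univ j⟩
      fun k _ => hup k ((le_abs_self _).trans_lt ((hd' k).trans_lt h))
    linarith
  have hCge : -(B * (1 / x j)) ≤ C := by
    by_contra! h
    have := Finset.sum_lt_sum_of_nonempty (s := Finset.univ) ⟨j, Finset.mem_univ j⟩
      fun k _ => hdown k (h.trans_le (neg_le_of_abs_le (hd' k)))
    linarith
  have hdouble (k : Fin K) (h : 2 * x k < y k) : 1 / x k / 2 ≤ C - d k :=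
    hinc k ▸ half_inv_le_hybridIncrement hκ (hx0 k) h.le
  have hhalf (k : Fin K) (h : 2 * y k < x k) : 1 / x k ≤ d k - C := by
    have h1 : 1 / y k / 2 ≤ d k - C := by
      have := half_inv_le_hybridIncrement hκ (hy0 k) h.le
      rw [hybridIncrement_swap, hinc] at this
      linarith
    have h2 := one_div_le_one_div_of_le (by linarith [hy0 k]) h.le
    have h3 : 1 / (2 * y k) = 1 / y k / 2 := by field_simp
    linarith
  have hsmall : B * (1 / x j) ≤ 1 / 16 * (1 / x j) :=
    mul_le_mul_of_nonneg_right hB' (by linarith [hinv j])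
  have hj : y j ≤ 2 * x j ∧ x j ≤ 2 * y j := by
    obtain ⟨h1, h2⟩ := abs_le.1 hdj
    constructor
    · by_contra! h
      linarith [hdouble j h, hinv j]
    · by_contra! h
      linarith [hhalf j h, hinv j]
  by_cases hij : i = j
  · exact hij ▸ hj
  obtain ⟨hdi1, hdi2⟩ := abs_le.1 (hd i hij)
  have hpair (f : Fin K → ℝ) (hf : ∑ k, f k = 0) (hf0 : ∀ k, k ≠ j → 0 ≤ f k) :
      f i + f j ≤ 0 := by
    rw [← Finset.add_sum_erase _ _ (Finset.mem_univ j)] at hf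
    have := Finset.single_le_sum (f := f) (s := Finset.univ.erase j)
      (fun k hk => hf0 k (Finset.ne_of_mem_erase hk)) (Finset.mem_erase.2 ⟨hij, Finset.mem_univ i⟩)
    linarith
  have hlt (h : 1 / x i < 1 / 2 * (1 / x j)) : 2 * x j < x i := by
    have h' : 1 / x i < 1 / (2 * x j) := by rwa [one_div_mul_one_div] at h
    exact (one_div_lt_one_div (hx0 i) (by linarith [hx0 j])).1 h'
  constructor
  · by_contra! h
    have h1 := hdouble i h
    have h2 := hlt (by linarith [hinv j])
    have h3 := hpair (fun k => y k - x k) (by simp [hxs, hys]) fun k hk =>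
      (sub_pos.2 (hup k (by linarith [(abs_le.1 (hd k hk)).2, hinv i]))).le
    linarith [hy0 j, hx0 j]
  · by_contra! h
    have h1 := hhalf i h
    have h2 := hlt (by linarith [hinv j])
    have h3 := hpair (fun k => x k - y k) (by simp [hxs, hys]) fun k hk =>
      (sub_pos.2 (hdown k (by linarith [(abs_le.1 (hd k hk)).1, hinv i]))).le
    linarith [hy0 i]

/-- **Multiplicative stability (Lemma 1 of the paper).**
One full round of the optimistic mirror descent update of Algorithm 2 (the
`ℓ̂`-update followed by the next optimistic `m⁺`-update) moves each coordinate
by at most a multiplicative factor of `2`. -/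
theorem multiplicative_stability
    (K : ℕ) (hK : 2 ≤ K) (η : ℝ) (hη : 0 < η) (hηK : η ≤ 1 / K) (hη' : η ≤ 1 / 162)
    (α : ℝ) (hα : α = 8 * η)
    (x' : Fin K → ℝ) (hx' : posSimplex K x')
    (m mplus ℓ : Fin K → ℝ)
    (hm : ∀ i, m i ∈ Set.Icc (0 : ℝ) 1)
    (hmplus : ∀ i, mplus i ∈ Set.Icc (0 : ℝ) 1)
    (hℓ : ∀ i, ℓ i ∈ Set.Icc (0 : ℝ) 1)
    (j : Fin K) (w : Fin K → ℝ) (hw : posSimplex K w)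
    (x : Fin K → ℝ) (hx : posSimplex K x)
    (hxmin : ∀ z, posSimplex K z →
      (∑ i, x i * m i) + hybridBreg K η x x' ≤ (∑ i, z i * m i) + hybridBreg K η z x')
    (hxw : ∀ i, x i ≤ w i / (1 - α))
    (x'plus : Fin K → ℝ) (hx'plus : posSimplex K x'plus)
    (hx'min : ∀ z, posSimplex K z →
      (∑ i, x'plus i * iwEstimator K ℓ m j w i) + hybridBreg K η x'plus x' ≤
        (∑ i, z i * iwEstimator K ℓ m j w i) + hybridBreg K η z x')
    (xplus : Fin K → ℝ) (hxplus : posSimplex K xplus)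
    (hxplusmin : ∀ z, posSimplex K z →
      (∑ i, xplus i * mplus i) + hybridBreg K η xplus x'plus ≤
        (∑ i, z i * mplus i) + hybridBreg K η z x'plus) :
    ∀ i, max (xplus i / x i) (x i / xplus i) ≤ 2 := by
  intro i
  have hgrad (y z : Fin K → ℝ) (k : Fin K) : hybridIncrement K (z k) (y k) =
      η * (hybridGradPsi K η y k - hybridGradPsi K η z k) := by
    simp only [hybridIncrement, hybridGradPsi]
    field_simp
    ring
  have hxj : 1 / w j ≤ 2 * (1 / x j) := by
    have h1 := hxw j
    rw [le_div_iff₀ (by linarith)] at h1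
    have h2 : x j ≤ 2 * w j := by nlinarith [hx.1 j]
    have h3 := one_div_le_one_div_of_le (hx.1 j) h2
    have h4 : 1 / (2 * w j) = 1 / w j / 2 := by field_simp
    linarith
  have hinv : 1 ≤ 1 / x j := by
    rw [le_div_iff₀ (hx.1 j), one_mul, ← hx.2]
    exact Finset.single_le_sum (fun l _ => (hx.1 l).le) (Finset.mem_univ j)
  have hwj : 0 < 1 / w j := one_div_pos.2 (hw.1 j)
  obtain ⟨h1, h2⟩ := le_two_mul_of_hybridIncrement (κ := K) (B := 3 * η) (j := j)
    (C := η * ((iwEstimator K ℓ m j w j + hybridGradPsi K η x'plus j - hybridGradPsi K η x' j) -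
      (m j + hybridGradPsi K η x j - hybridGradPsi K η x' j) +
      (mplus j + hybridGradPsi K η xplus j - hybridGradPsi K η x'plus j)))
    (d := fun k => η * (mplus k + (iwEstimator K ℓ m j w k - m k)))
    (Nat.cast_nonneg K) (by positivity) (by linarith) hx hxplus
    (fun k => by
      rw [hgrad, hybridObjective_grad_eq_of_min hx hxmin j k,
        hybridObjective_grad_eq_of_min hx'plus hx'min j k,
        hybridObjective_grad_eq_of_min hxplus hxplusmin j k]
      ring)
    (fun k hk => by
      simp only [iwEstimator, if_neg hk, sub_self, add_zero]
      rw [abs_of_nonneg (mul_nonneg hη.le (hmplus k).1)]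
      nlinarith [(hmplus k).2])
    (by
      have h : |mplus j + (ℓ j - m j) * (1 / w j)| ≤ 3 * (1 / x j) := by
        obtain ⟨hm0, hm1⟩ := hm j
        obtain ⟨hl0, hl1⟩ := hℓ j
        obtain ⟨hp0, hp1⟩ := hmplus j
        rw [abs_le]
        constructor <;> nlinarith
      have h' : iwEstimator K ℓ m j w j - m j = (ℓ j - m j) * (1 / w j) := by
        simp only [iwEstimator, if_true]
        ring
      simp only [h', abs_mul, abs_of_pos hη]
      nlinarith)
    i
  exact max_le ((div_le_iff₀ (hx.1 i)).2 h1) ((div_le_iff₀ (hxplus.1 i)).2 h2)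
end

section
/- Fix integers K ≥ 2 and reals η with 0 < η ≤ min{1/K, 1/162}; set α = 8η. Let x' ∈ Δ_K have all coordinates positive, let m, ℓ ∈ [0,1]^K, let j ∈ {1,…,K}, and let w ∈ Δ_K have all coordinates positive. Suppose x ∈ Δ_K has all coordinates positive and minimizes ⟨·, m⟩ + D_ψ(·, x') over Δ_K points with positive coordinates, x_i ≤ w_i/(1−α) for all i, and x'⁺ ∈ Δ_K has all coordinates positive and minimizes ⟨·, ℓ̂⟩ + D_ψ(·, x') over Δ_K points with positive coordinates, where ℓ̂ is the importance-weighted optimistic estimator built from ℓ, m, j, w. Then for every i ∈ {1,…,K}, max{x'⁺_i/x_i, x_i/x'⁺_i} ≤ 27/26. -/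
open Finset

/-- Along any direction that preserves the coordinate sum, the linearized objective vanishes at a
minimizer over the open simplex. -/
lemma sum_mul_gradient_eq_zero_of_minimizer {K : ℕ} {η : ℝ} {x y c : Fin K → ℝ}
    (hx : posSimplex K x)
    (hmin : ∀ z, posSimplex K z →
      (∑ i, x i * c i) + hybridBreg K η x y ≤ (∑ i, z i * c i) + hybridBreg K η z y)
    (v : Fin K → ℝ) (hv : ∑ i, v i = 0) :
    ∑ i, v i * (c i + hybridGradPsi K η x i - hybridGradPsi K η y i) = 0 := by
  have hline : ∀ i, HasDerivAt (fun t : ℝ => x i + t * v i) (v i) 0 := fun i => by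
    simpa using ((hasDerivAt_id (0 : ℝ)).mul_const (v i)).const_add (x i)
  have hlog : ∀ i, HasDerivAt (fun t : ℝ => Real.log (x i + t * v i)) (v i / x i) 0 := fun i => by
    simpa using (hline i).log (by simpa using (hx.1 i).ne')
  have hlin : HasDerivAt (fun t : ℝ => ∑ i, (x i + t * v i) * c i) (∑ i, v i * c i) 0 :=
    HasDerivAt.fun_sum fun i _ => (hline i).mul_const (c i)
  have hbarrier : HasDerivAt (fun t : ℝ => ∑ i, Real.log (1 / (x i + t * v i)))
      (∑ i, -(v i / x i)) 0 := by
    simp only [one_div, Real.log_inv]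
    exact HasDerivAt.fun_sum fun i _ => (hlog i).neg
  have hentropy : HasDerivAt
      (fun t : ℝ => ∑ i, (x i + t * v i) * Real.log (x i + t * v i))
      (∑ i, v i * (Real.log (x i) + 1)) 0 := by
    refine HasDerivAt.fun_sum fun i _ => ?_
    have hne := (hx.1 i).ne'
    refine ((hline i).mul (hlog i)).congr_deriv ?_
    rw [zero_mul, add_zero]
    field_simp
  have hlinear : HasDerivAt
      (fun t : ℝ => ∑ i, hybridGradPsi K η y i * (x i + t * v i - y i))
      (∑ i, hybridGradPsi K η y i * v i) 0 :=
    HasDerivAt.fun_sum fun i _ => ((hline i).sub_const (y i)).const_mul _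
  have hderiv := hlin.add
    ((((hbarrier.const_mul (1 / η)).add (hentropy.const_mul ((K : ℝ) / η))).sub_const
      (hybridPsi K η y)).sub hlinear)
  have hpos : ∀ᶠ t : ℝ in nhds 0, ∀ i, 0 < x i + t * v i := by
    refine Filter.eventually_all.2 fun i => (hline i).continuousAt.eventually_const_lt ?_
    simpa using hx.1 i
  have hloc : IsLocalMin (fun t : ℝ => (∑ i, (x i + t * v i) * c i) +
      hybridBreg K η (fun i => x i + t * v i) y) 0 := by
    filter_upwards [hpos] with t ht
    simpa using hmin (fun i => x i + t * v i)
      ⟨ht, by rw [sum_add_distrib, ← mul_sum, hv, hx.2]; simp⟩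
  have hzero := hloc.hasDerivAt_eq_zero hderiv
  rw [← hzero]
  simp only [mul_sum, ← sum_add_distrib, ← sum_sub_distrib]
  refine sum_congr rfl fun i _ => ?_
  simp only [hybridGradPsi]
  ring

/-- The gradient of the objective is a constant vector at a minimizer over the open simplex. -/
lemma gradient_eq_of_minimizer {K : ℕ} {η : ℝ} {x y c : Fin K → ℝ}
    (hx : posSimplex K x)
    (hmin : ∀ z, posSimplex K z →
      (∑ i, x i * c i) + hybridBreg K η x y ≤ (∑ i, z i * c i) + hybridBreg K η z y)
    (i k : Fin K) :
    c i + hybridGradPsi K η x i - hybridGradPsi K η y i =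
      c k + hybridGradPsi K η x k - hybridGradPsi K η y k := by
  have h := sum_mul_gradient_eq_zero_of_minimizer hx hmin
    (fun l => (if l = i then 1 else 0) - if l = k then 1 else 0) (by simp)
  simp only [sub_mul, sum_sub_distrib, ite_mul, one_mul, zero_mul, sum_ite_eq', mem_univ,
    if_true] at h
  linarith

/-- The increment from `s` to `t` of the scalar function `u ↦ -1/u + K ln u`, which is `η` times
the coordinate gradient of the hybrid regularizer up to a constant. -/
noncomputable def gradIncrement (K : ℕ) (s t : ℝ) : ℝ :=
  1 / s - 1 / t + K * (Real.log t - Real.log s)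

lemma gradIncrement_swap (K : ℕ) (s t : ℝ) : gradIncrement K t s = -gradIncrement K s t := by
  unfold gradIncrement
  ring

lemma inv_sub_inv_le_gradIncrement (K : ℕ) {s t : ℝ} (hs : 0 < s) (hst : s ≤ t) :
    1 / s - 1 / t ≤ gradIncrement K s t := by
  have := mul_nonneg K.cast_nonneg (sub_nonneg.2 (Real.log_le_log hs hst))
  unfold gradIncrement
  linarith

lemma gradIncrement_nonneg (K : ℕ) {s t : ℝ} (hs : 0 < s) (hst : s ≤ t) :
    0 ≤ gradIncrement K s t :=
  (sub_nonneg.2 (one_div_le_one_div_of_le hs hst)).trans (inv_sub_inv_le_gradIncrement K hs hst)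

lemma gradIncrement_pos (K : ℕ) {s t : ℝ} (hs : 0 < s) (hst : s < t) :
    0 < gradIncrement K s t :=
  (sub_pos.2 (one_div_lt_one_div_of_lt hs hst)).trans_le (inv_sub_inv_le_gradIncrement K hs hst.le)

lemma le_of_gradIncrement_nonneg {K : ℕ} {s t : ℝ} (ht : 0 < t) (h : 0 ≤ gradIncrement K s t) :
    s ≤ t := by
  by_contra! hlt
  have := gradIncrement_pos K ht hlt
  rw [gradIncrement_swap] at this
  linarith

lemma mul_le_gradIncrement (K : ℕ) {s t : ℝ} (hs : 0 < s) (ht : 0 < t) :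
    (1 - s / t) * (1 / s + K) ≤ gradIncrement K s t := by
  have h := Real.one_sub_inv_le_log_of_pos (div_pos ht hs)
  rw [inv_div, Real.log_div ht.ne' hs.ne'] at h
  have hK := mul_le_mul_of_nonneg_left h (K.cast_nonneg (α := ℝ))
  have : 1 / s - 1 / t = (1 - s / t) * (1 / s) := by field_simp
  unfold gradIncrement
  linarith

lemma gradIncrement_le_mul (K : ℕ) {s t : ℝ} (hs : 0 < s) (ht : 0 < t) :
    gradIncrement K s t ≤ (t - s) / s * (1 / t + K) := by
  have h := Real.log_le_sub_one_of_pos (div_pos ht hs)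
  rw [Real.log_div ht.ne' hs.ne'] at h
  have hK := mul_le_mul_of_nonneg_left h (K.cast_nonneg (α := ℝ))
  have h1 : 1 / s - 1 / t = (t - s) / s * (1 / t) := by field_simp
  have h2 : t / s - 1 = (t - s) / s := by field_simp
  rw [h2] at hK
  unfold gradIncrement
  linarith

lemma le_mul_of_gradIncrement_le {K : ℕ} {s t D : ℝ} (hs : 0 < s) (hst : s ≤ t)
    (h : gradIncrement K s t ≤ D) : t ≤ s + D * t * s := by
  have h1 := (inv_sub_inv_le_gradIncrement K hs hst).trans h
  have ht := hs.trans_le hst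
  have h2 : 1 / s - 1 / t = (t - s) / (t * s) := by field_simp
  rw [h2, div_le_iff₀ (mul_pos ht hs)] at h1
  linarith

/-- If the gradient increments between two points of the simplex agree at all coordinates except
`j`, where the increment is smaller by `D`, then the common increment lies in `[0, D]`. -/
lemma common_increment_mem_Icc {K : ℕ} {a b : Fin K → ℝ} (ha : posSimplex K a)
    (hb : posSimplex K b) (j : Fin K) {e D : ℝ} (hD : 0 ≤ D)
    (h : ∀ i, gradIncrement K (a i) (b i) = e - if i = j then D else 0) :
    e ∈ Set.Icc 0 D := by
  have hsum := ha.2.trans hb.2.symm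
  constructor
  · by_contra! he
    refine (sum_lt_sum_of_nonempty ⟨j, mem_univ j⟩ fun i _ => ?_).ne' hsum
    by_contra! hle
    have := gradIncrement_nonneg K (ha.1 i) hle
    rw [h i] at this
    split_ifs at this <;> linarith
  · by_contra! he
    refine (sum_lt_sum_of_nonempty ⟨j, mem_univ j⟩ fun i _ => ?_).ne hsum
    by_contra! hle
    have := gradIncrement_nonneg K (hb.1 i) hle
    rw [gradIncrement_swap, h i] at this
    split_ifs at this <;> linarith

lemma max_div_le_of_gradIncrement_eq {K : ℕ} {a b : Fin K → ℝ} (hK : 0 < K)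
    (ha : posSimplex K a) (hb : posSimplex K b) (j : Fin K) {e D : ℝ} (hD : 0 ≤ D)
    (h : ∀ i, gradIncrement K (a i) (b i) = e - if i = j then D else 0)
    (hDa : D * a j ≤ 1 / 153) (i : Fin K) :
    max (b i / a i) (a i / b i) ≤ 27 / 26 := by
  obtain ⟨he, heD⟩ := common_increment_mem_Icc ha hb j hD h
  have hK' : (0 : ℝ) < K := by exact_mod_cast hK
  have haj := ha.1 j
  have hbj := hb.1 j
  have hj : gradIncrement K (b j) (a j) = D - e := by
    rw [gradIncrement_swap, h j, if_pos rfl]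
    ring
  have hne : ∀ i, i ≠ j → gradIncrement K (a i) (b i) = e := fun i hi => by
    rw [h i, if_neg hi, sub_zero]
  have hba : b j ≤ a j := le_of_gradIncrement_nonneg haj (by rw [hj]; linarith)
  have hab : a j ≤ b j + 1 / 153 * b j := by
    have h1 := le_mul_of_gradIncrement_le hbj hba (D := D) (by rw [hj]; linarith)
    have h2 := mul_le_mul_of_nonneg_right hDa hbj.le
    linarith
  have hle : ∀ i, i ≠ j → a i ≤ b i := fun i hi =>
    le_of_gradIncrement_nonneg (hb.1 i) (by rw [hne i hi]; exact he)
  have hai := ha.1 i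
  have hbi := hb.1 i
  rw [max_le_iff, div_le_iff₀ hai, div_le_iff₀ hbi]
  by_cases hi : i = j
  · subst hi
    constructor <;> linarith
  refine ⟨?_, by linarith [hle i hi]⟩
  by_contra! hbig
  have hai1 : a i ≤ 1 := ha.2 ▸ single_le_sum (fun k _ => (ha.1 k).le) (mem_univ i)
  have he_large : (1 + K) / 27 ≤ e := by
    have h1 := mul_le_gradIncrement K hai hbi
    rw [hne i hi] at h1
    have h2 : 1 / 27 ≤ 1 - a i / b i := by
      have : a i / b i ≤ 26 / 27 := by rw [div_le_iff₀ hbi]; linarith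
      linarith
    have h3 : 1 + (K : ℝ) ≤ 1 / a i + K := by
      have : 1 ≤ 1 / a i := by rwa [le_div_iff₀ hai, one_mul]
      linarith
    have h4 := mul_le_mul h2 h3 (by positivity) (by linarith)
    linarith
  have haj_small : (1 + K) * a j ≤ 27 / 153 := by
    have := mul_le_mul_of_nonneg_right (he_large.trans heD) haj.le
    linarith
  obtain ⟨k, -, hk⟩ : ∃ k ∈ (univ : Finset (Fin K)), 1 / (K : ℝ) ≤ a k :=
    exists_le_of_sum_le ⟨j, mem_univ j⟩ (by simp [ha.2, hK'.ne'])
  rw [div_le_iff₀ hK'] at hk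
  have hkj : k ≠ j := by
    rintro rfl
    linarith
  have hak := ha.1 k
  have hakb := hle k hkj
  have hbk := hak.trans_le hakb
  have hdiff : b k - a k ≤ a j - b j := by
    have h1 := sum_erase_add univ a (mem_univ j)
    have h2 := sum_erase_add univ b (mem_univ j)
    have h3 := single_le_sum (s := univ.erase j) (f := fun i => b i - a i)
      (fun i hi => sub_nonneg.2 (hle i (ne_of_mem_erase hi))) (mem_erase.2 ⟨hkj, mem_univ k⟩)
    rw [sum_sub_distrib] at h3
    linarith [ha.2, hb.2]
  have he_small : e ≤ (a j - b j) * K * (K + K) := by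
    have h1 := gradIncrement_le_mul K hak hbk
    rw [hne k hkj] at h1
    have hinv : 1 / b k ≤ K := by
      rw [div_le_iff₀ hbk]
      nlinarith
    have hquot : (b k - a k) / a k ≤ (a j - b j) * K := by
      rw [div_le_iff₀ hak]
      nlinarith [mul_le_mul_of_nonneg_left hk (sub_nonneg.2 hba)]
    refine h1.trans (mul_le_mul hquot (by linarith) (by positivity) ?_)
    exact mul_nonneg (sub_nonneg.2 hba) hK'.le
  have hgap : (a j - b j) * K ≤ 27 / 153 / 153 := by
    have : a j - b j ≤ 1 / 153 * a j := by linarith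
    nlinarith
  have := mul_le_mul_of_nonneg_right hgap (add_pos hK' hK').le
  linarith

/-- **Inequality (to_prove1) in the proof of the multiplicative stability lemma.**
The `ℓ̂`-update of Algorithm 2 moves each coordinate of `x` by at most a
multiplicative factor of `27/26`. -/
theorem stability_estimator_step
    (K : ℕ) (hK : 2 ≤ K) (η : ℝ) (hη : 0 < η) (hηK : η ≤ 1 / K) (hη' : η ≤ 1 / 162)
    (α : ℝ) (hα : α = 8 * η)
    (x' : Fin K → ℝ) (hx' : posSimplex K x')
    (m ℓ : Fin K → ℝ)
    (hm : ∀ i, m i ∈ Set.Icc (0 : ℝ) 1)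
    (hℓ : ∀ i, ℓ i ∈ Set.Icc (0 : ℝ) 1)
    (j : Fin K) (w : Fin K → ℝ) (hw : posSimplex K w)
    (x : Fin K → ℝ) (hx : posSimplex K x)
    (hxmin : ∀ z, posSimplex K z →
      (∑ i, x i * m i) + hybridBreg K η x x' ≤ (∑ i, z i * m i) + hybridBreg K η z x')
    (hxw : ∀ i, x i ≤ w i / (1 - α))
    (x'plus : Fin K → ℝ) (hx'plus : posSimplex K x'plus)
    (hx'min : ∀ z, posSimplex K z →
      (∑ i, x'plus i * iwEstimator K ℓ m j w i) + hybridBreg K η x'plus x' ≤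
        (∑ i, z i * iwEstimator K ℓ m j w i) + hybridBreg K η z x') :
    ∀ i, max (x'plus i / x i) (x i / x'plus i) ≤ 27 / 26 := by
  have hK0 : 0 < K := by lia
  have hwj := hw.1 j
  have hxj := hx.1 j
  have hgrad : ∀ i, gradIncrement K (x i) (x'plus i) =
      η * (hybridGradPsi K η (x'plus) i - hybridGradPsi K η x i) := fun i => by
    unfold gradIncrement hybridGradPsi
    field_simp
    ring
  obtain ⟨e, he⟩ : ∃ e, ∀ i, gradIncrement K (x i) (x'plus i) =
      e - if i = j then η * ((ℓ j - m j) / w j) else 0 := by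
    refine ⟨η * (hybridGradPsi K η x'plus j - hybridGradPsi K η x j + (ℓ j - m j) / w j),
      fun i => ?_⟩
    have h1 := gradient_eq_of_minimizer hx hxmin i j
    have h2 := gradient_eq_of_minimizer hx'plus hx'min i j
    rw [hgrad i]
    by_cases hi : i = j
    · subst hi
      simp only [if_true]
      ring
    · simp only [iwEstimator, if_neg hi, if_true] at h2
      rw [if_neg hi, sub_zero]
      congr 1
      linarith
  have hbound : η * (|ℓ j - m j| / w j) * x j ≤ 1 / 154 := by
    have habs : |ℓ j - m j| ≤ 1 :=
      abs_sub_le_iff.2 ⟨by linarith [(hℓ j).2, (hm j).1], by linarith [(hm j).2, (hℓ j).1]⟩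
    have h1 := hxw j
    rw [le_div_iff₀ (by linarith)] at h1
    have h2 : x j ≤ 162 / 154 * w j := by nlinarith
    have h3 : |ℓ j - m j| / w j * x j ≤ 162 / 154 := by
      rw [div_mul_eq_mul_div, div_le_iff₀ hwj]
      nlinarith
    calc η * (|ℓ j - m j| / w j) * x j = η * (|ℓ j - m j| / w j * x j) := by ring
      _ ≤ 1 / 162 * (162 / 154) := by gcongr
      _ = 1 / 154 := by norm_num
  rcases le_total 0 (ℓ j - m j) with hs | hs
  · rw [abs_of_nonneg hs] at hbound
    exact max_div_le_of_gradIncrement_eq hK0 hx hx'plus j (by positivity) he (by linarith)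
  · rw [abs_of_nonpos hs] at hbound
    have hD : 0 ≤ η * (-(ℓ j - m j) / w j) :=
      mul_nonneg hη.le (div_nonneg (neg_nonneg.2 hs) hwj.le)
    have hswap : ∀ i, gradIncrement K (x'plus i) (x i) =
        -e - if i = j then η * (-(ℓ j - m j) / w j) else 0 := fun i => by
      rw [gradIncrement_swap, he i]
      split_ifs <;> ring
    obtain ⟨he0, heD⟩ := common_increment_mem_Icc hx'plus hx j hD hswap
    have hinc : gradIncrement K (x j) (x'plus j) = η * (-(ℓ j - m j) / w j) + e := by
      rw [he j, if_pos rfl]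
      ring
    have hle : x j ≤ x'plus j :=
      le_of_gradIncrement_nonneg (hx'plus.1 j) (by rw [hinc]; linarith)
    have hmul := le_mul_of_gradIncrement_le hxj hle
      (D := η * (-(ℓ j - m j) / w j)) (by rw [hinc]; linarith)
    have hratio : x'plus j ≤ 154 / 153 * x j := by
      have := mul_le_mul_of_nonneg_right hbound (hx'plus.1 j).le
      linarith
    intro i
    rw [max_comm]
    refine max_div_le_of_gradIncrement_eq hK0 hx'plus hx j hD hswap ?_ i
    have := mul_le_mul_of_nonneg_left hratio hD
    linarith
end

section
/- Fix an integer K ≥ 2 and a real η with 0 < η ≤ 1/162. Let y ∈ Δ_K have all coordinates positive, let m ∈ [0,1]^K, and suppose x ∈ Δ_K has all coordinates positive and minimizes ⟨·, m⟩ + D_ψ(·, y) over all points of Δ_K with positive coordinates. Then for every i ∈ {1,…,K}, max{x_i/y_i, y_i/x_i} ≤ 27/26. -/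
open Finset

/-- The directional derivative of the hybrid regularizer at a positive point. -/
theorem hasDerivAt_hybridPsi_line (K : ℕ) (η : ℝ) (x d : Fin K → ℝ) (hx : ∀ i, 0 < x i) :
    HasDerivAt (fun t : ℝ => hybridPsi K η (fun i => x i + t * d i))
      (∑ i, hybridGradPsi K η x i * d i) 0 := by
  have hline : ∀ i, HasDerivAt (fun t : ℝ => x i + t * d i) (d i) 0 := fun i => by
    simpa using ((hasDerivAt_id (0 : ℝ)).mul_const (d i)).const_add (x i)
  have hlog : ∀ i, HasDerivAt (fun t : ℝ => Real.log (x i + t * d i)) (d i / x i) 0 := fun i => by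
    simpa using (hline i).log (by simpa using (hx i).ne')
  have hbarrier : HasDerivAt (fun t : ℝ => ∑ i, Real.log (1 / (x i + t * d i)))
      (∑ i, -(d i / x i)) 0 :=
    HasDerivAt.fun_sum fun i _ => by simpa using (hlog i).fun_neg
  have hentropy : HasDerivAt (fun t : ℝ => ∑ i, (x i + t * d i) * Real.log (x i + t * d i))
      (∑ i, (d i * Real.log (x i) + x i * (d i / x i))) 0 :=
    HasDerivAt.fun_sum fun i _ => by simpa using (hline i).fun_mul (hlog i)
  refine ((hbarrier.const_mul (1 / η)).add (hentropy.const_mul ((K : ℝ) / η))).congr_deriv ?_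
  rw [Finset.mul_sum, Finset.mul_sum, ← Finset.sum_add_distrib]
  refine Finset.sum_congr rfl fun i _ => ?_
  have := (hx i).ne'
  rw [hybridGradPsi, mul_div_cancel₀ _ this]
  ring

/-- First-order optimality of a minimizer of the regularized objective over the open simplex. -/
theorem sum_direction_mul_gradient_eq_zero (K : ℕ) (η : ℝ) (y m x : Fin K → ℝ)
    (hx : posSimplex K x)
    (hxmin : ∀ z, posSimplex K z →
      (∑ i, x i * m i) + hybridBreg K η x y ≤ (∑ i, z i * m i) + hybridBreg K η z y)
    (d : Fin K → ℝ) (hd : ∑ i, d i = 0) :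
    ∑ i, d i * (m i + hybridGradPsi K η x i - hybridGradPsi K η y i) = 0 := by
  have hline : ∀ i, HasDerivAt (fun t : ℝ => x i + t * d i) (d i) 0 := fun i => by
    simpa using ((hasDerivAt_id (0 : ℝ)).mul_const (d i)).const_add (x i)
  have hlin : HasDerivAt (fun t : ℝ => ∑ i, (x i + t * d i) * m i) (∑ i, d i * m i) 0 :=
    HasDerivAt.fun_sum fun i _ => (hline i).mul_const _
  have hgrad : HasDerivAt (fun t : ℝ => ∑ i, hybridGradPsi K η y i * (x i + t * d i - y i))
      (∑ i, hybridGradPsi K η y i * d i) 0 :=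
    HasDerivAt.fun_sum fun i _ => ((hline i).sub_const _).const_mul _
  have hobj : HasDerivAt (fun t : ℝ => (∑ i, (x i + t * d i) * m i) +
      hybridBreg K η (fun i => x i + t * d i) y) _ 0 :=
    hlin.add (((hasDerivAt_hybridPsi_line K η x d hx.1).sub_const (hybridPsi K η y)).sub hgrad)
  have hmin : IsLocalMin (fun t : ℝ => (∑ i, (x i + t * d i) * m i) +
      hybridBreg K η (fun i => x i + t * d i) y) 0 := by
    have hpos : ∀ᶠ t in nhds (0 : ℝ), ∀ i, 0 < x i + t * d i :=
      Filter.eventually_all.2 fun i =>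
        (hline i).continuousAt.eventually (lt_mem_nhds (by simpa using hx.1 i))
    filter_upwards [hpos] with t ht
    have hz := hxmin (fun i => x i + t * d i)
      ⟨ht, by rw [Finset.sum_add_distrib, ← Finset.mul_sum, hd, hx.2]; simp⟩
    simpa using hz
  rw [← hmin.hasDerivAt_eq_zero hobj, ← Finset.sum_sub_distrib, ← Finset.sum_add_distrib]
  exact Finset.sum_congr rfl fun i _ => by ring

/-- The optimality residual `m + ∇ψ(x) − ∇ψ(y)` of a minimizer is a constant vector. -/
theorem gradient_residual_eq (K : ℕ) (η : ℝ) (y m x : Fin K → ℝ) (hx : posSimplex K x)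
    (hxmin : ∀ z, posSimplex K z →
      (∑ i, x i * m i) + hybridBreg K η x y ≤ (∑ i, z i * m i) + hybridBreg K η z y)
    (i j : Fin K) :
    m i + hybridGradPsi K η x i - hybridGradPsi K η y i =
      m j + hybridGradPsi K η x j - hybridGradPsi K η y j := by
  have h := sum_direction_mul_gradient_eq_zero K η y m x hx hxmin
    (fun k => (if k = i then 1 else 0) - (if k = j then 1 else 0)) (by simp)
  simp only [sub_mul, Finset.sum_sub_distrib, ite_mul, one_mul, zero_mul, Finset.sum_ite_eq',
    Finset.mem_univ, if_true] at h
  linarith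

/-- The gradient of the hybrid regularizer is monotone in each coordinate. -/
theorem hybridGradPsi_le_of_le (K : ℕ) (η : ℝ) (hη : 0 < η) (u v : Fin K → ℝ) (i : Fin K)
    (hu : 0 < u i) (huv : u i ≤ v i) : hybridGradPsi K η u i ≤ hybridGradPsi K η v i := by
  unfold hybridGradPsi
  gcongr

/-- A gap of at most one between gradient coordinates bounds the ratio of the coordinates. -/
theorem div_le_of_hybridGradPsi_sub_le_one (K : ℕ) (hK : 2 ≤ K) (η : ℝ) (hη : 0 < η)
    (hη' : η ≤ 1 / 162) (u v : Fin K → ℝ) (i : Fin K) (hu : 0 < u i) (hv : 0 < v i)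
    (h : hybridGradPsi K η u i - hybridGradPsi K η v i ≤ 1) : u i / v i ≤ 27 / 26 := by
  rcases le_total (u i) (v i) with huv | huv
  · exact ((div_le_one hv).2 huv).trans (by norm_num)
  have hgap : (1 / v i - 1 / u i) + K * (Real.log (u i) - Real.log (v i)) ≤ η := by
    calc _ = η * (hybridGradPsi K η u i - hybridGradPsi K η v i) := by
          unfold hybridGradPsi
          field_simp
          ring
      _ ≤ η * 1 := by gcongr
      _ = η := mul_one η
  have hinv : 1 / u i ≤ 1 / v i := one_div_le_one_div_of_le hv huv
  have hlog : 1 - v i / u i ≤ Real.log (u i) - Real.log (v i) := by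
    have := Real.one_sub_inv_le_log_of_pos (div_pos hu hv)
    rwa [Real.log_div hu.ne' hv.ne', inv_div] at this
  have hratio : v i / u i ≤ 1 := (div_le_one hu).2 huv
  have hK' : (2 : ℝ) ≤ K := by exact_mod_cast hK
  have hbound : 26 / 27 ≤ v i / u i := by nlinarith
  rw [le_div_iff₀ hu] at hbound
  rw [div_le_iff₀ hv]
  linarith

/-- **Inequality (to_prove2) in the proof of the multiplicative stability lemma.**
The optimistic step of Algorithm 2 with a prediction vector `m ∈ [0,1]^K` moves any
interior point of the simplex by at most a `27/26` multiplicative factor per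
coordinate. -/
theorem stability_optimistic_step
    (K : ℕ) (hK : 2 ≤ K) (η : ℝ) (hη : 0 < η) (hη' : η ≤ 1 / 162)
    (y : Fin K → ℝ) (hy : posSimplex K y)
    (m : Fin K → ℝ) (hm : ∀ i, m i ∈ Set.Icc (0 : ℝ) 1)
    (x : Fin K → ℝ) (hx : posSimplex K x)
    (hxmin : ∀ z, posSimplex K z →
      (∑ i, x i * m i) + hybridBreg K η x y ≤ (∑ i, z i * m i) + hybridBreg K η z y) :
    ∀ i, max (x i / y i) (y i / x i) ≤ 27 / 26 := by
  have hresid := gradient_residual_eq K η y m x hx hxmin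
  have : Nonempty (Fin K) := ⟨⟨0, by lia⟩⟩
  have hsum : ∑ i, x i = ∑ i, y i := hx.2.trans hy.2.symm
  obtain ⟨a, -, ha⟩ := Finset.exists_le_of_sum_le Finset.univ_nonempty hsum.le
  obtain ⟨b, -, hb⟩ := Finset.exists_le_of_sum_le Finset.univ_nonempty hsum.ge
  have hga := hybridGradPsi_le_of_le K η hη x y a (hx.1 a) ha
  have hgb := hybridGradPsi_le_of_le K η hη y x b (hy.1 b) hb
  intro i
  refine max_le
    (div_le_of_hybridGradPsi_sub_le_one K hK η hη hη' x y i (hx.1 i) (hy.1 i) ?_)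
    (div_le_of_hybridGradPsi_sub_le_one K hK η hη hη' y x i (hy.1 i) (hx.1 i) ?_)
  · linarith [hresid i a, (hm i).1, (hm a).2]
  · linarith [hresid i b, (hm i).2, (hm b).1]
end

section
/- Fix an integer K ≥ 2 and reals η > 0 and α ∈ (0,1). Let ℓ, m ∈ [0,1]^K, j ∈ {1,…,K}, let w ∈ Δ_K have all coordinates positive, let x ∈ Δ_K have all coordinates positive with x_j ≤ w_j/(1−α), and let ℓ̂ be the importance-weighted optimistic estimator built from ℓ, m, j, w. Then ‖ℓ̂ − m‖²_{∇⁻²ψ(x)} ≤ (η/(1−α)²)·min{(ℓ_j − m_j)², (ℓ_j − m_j)²/(K·x_j)}; in particular ‖ℓ̂ − m‖²_{∇⁻²ψ(x)} ≤ η/(1−α)². -/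
open Finset

/-- The squared dual local norm of the estimation error is carried by the played arm alone. -/
theorem invHessNormSq_iwEstimator_sub (K : ℕ) (η : ℝ) (ℓ m : Fin K → ℝ) (j : Fin K)
    (w x : Fin K → ℝ) (hx : 0 < x j) :
    invHessNormSq K η x (fun i => iwEstimator K ℓ m j w i - m i) =
      η * (x j / w j) ^ 2 * ((ℓ j - m j) ^ 2 / (1 + (K : ℝ) * x j)) := by
  have hK : 0 < 1 + (K : ℝ) * x j := by positivity
  have hess : hybridHess K η x j = (1 + (K : ℝ) * x j) / (η * x j ^ 2) := by
    unfold hybridHess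
    field_simp
  unfold invHessNormSq
  rw [Finset.sum_eq_single j (fun i _ hi => by simp [iwEstimator, hi]) (by simp), hess]
  simp only [iwEstimator, if_true, add_sub_cancel_right, div_pow, div_div_eq_mul_div]
  ring

/-- **Variance bound on the estimator in the inverse-Hessian norm** (used in the
proofs of Lemmas 1 and 3 of the paper). -/
theorem estimator_variance_bound
    (K : ℕ) (hK : 2 ≤ K) (η : ℝ) (hη : 0 < η)
    (α : ℝ) (hα0 : 0 < α) (hα1 : α < 1)
    (ℓ m : Fin K → ℝ)
    (hℓ : ∀ i, ℓ i ∈ Set.Icc (0 : ℝ) 1)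
    (hm : ∀ i, m i ∈ Set.Icc (0 : ℝ) 1)
    (j : Fin K) (w : Fin K → ℝ) (hw : posSimplex K w)
    (x : Fin K → ℝ) (hx : posSimplex K x)
    (hxw : x j ≤ w j / (1 - α)) :
    invHessNormSq K η x (fun i => iwEstimator K ℓ m j w i - m i) ≤
        (η / (1 - α) ^ 2) *
          min ((ℓ j - m j) ^ 2) ((ℓ j - m j) ^ 2 / ((K : ℝ) * x j)) ∧
      invHessNormSq K η x (fun i => iwEstimator K ℓ m j w i - m i) ≤ η / (1 - α) ^ 2 := by
  have hxj : 0 < x j := hx.1 j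
  have hwj : 0 < w j := hw.1 j
  have hα : 0 < 1 - α := sub_pos.2 hα1
  have hKx : 0 < (K : ℝ) * x j := mul_pos (by exact_mod_cast (by omega : 0 < K)) hxj
  have hratio : (x j / w j) ^ 2 ≤ 1 / (1 - α) ^ 2 := by
    rw [← one_div_pow]
    refine pow_le_pow_left₀ (by positivity) ?_ 2
    rw [div_le_iff₀ hwj]
    exact hxw.trans_eq (by ring)
  have hmin : (ℓ j - m j) ^ 2 / (1 + (K : ℝ) * x j) ≤
      min ((ℓ j - m j) ^ 2) ((ℓ j - m j) ^ 2 / ((K : ℝ) * x j)) :=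
    le_min (div_le_self (sq_nonneg _) (by linarith))
      (div_le_div_of_nonneg_left (sq_nonneg _) hKx (by linarith))
  have hbound : invHessNormSq K η x (fun i => iwEstimator K ℓ m j w i - m i) ≤
      (η / (1 - α) ^ 2) *
        min ((ℓ j - m j) ^ 2) ((ℓ j - m j) ^ 2 / ((K : ℝ) * x j)) := by
    rw [invHessNormSq_iwEstimator_sub K η ℓ m j w x hxj, ← mul_one_div η]
    gcongr
  have hloss : (ℓ j - m j) ^ 2 ≤ 1 := by
    rw [sq_le_one_iff_abs_le_one, abs_le]
    constructor <;> linarith [(hℓ j).1, (hℓ j).2, (hm j).1, (hm j).2]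
  exact ⟨hbound, hbound.trans
    (mul_le_of_le_one_right (by positivity) ((min_le_left _ _).trans hloss))⟩
end

section
/- Fix an integer K ≥ 2 and a real η with 0 < η ≤ min{1/K, 1/162}; set α = 8η. Let x' ∈ Δ_K have all coordinates positive, let ℓ, m ∈ [0,1]^K, let j ∈ {1,…,K}, let w ∈ Δ_K have all coordinates positive, and let ℓ̂ be the importance-weighted optimistic estimator built from ℓ, m, j, w. Suppose x ∈ Δ_K has all coordinates positive, minimizes ⟨·, m⟩ + D_ψ(·, x') over Δ_K points with positive coordinates, and satisfies x_i ≤ w_i/(1−α) for all i; and suppose y ∈ Δ_K has all coordinates positive and minimizes ⟨·, ℓ̂⟩ + D_ψ(·, x') over Δ_K points with positive coordinates. Then ⟨x − y, ℓ̂ − m⟩ ≤ 4η·min{(ℓ_j − m_j)², (ℓ_j − m_j)²/(K·x_j)}. -/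
open Finset

open Filter Topology in
/-- First-order optimality for a positive minimizer of a linear function plus the Bregman
divergence: the gradient is orthogonal to every direction summing to zero. -/
lemma sum_mul_grad_eq_zero_of_min {K : ℕ} {η : ℝ} {a x x' : Fin K → ℝ} (hx : posSimplex K x)
    (hmin : ∀ z, posSimplex K z →
      (∑ i, x i * a i) + hybridBreg K η x x' ≤ (∑ i, z i * a i) + hybridBreg K η z x')
    {d : Fin K → ℝ} (hd : ∑ i, d i = 0) :
    ∑ i, d i * (a i + hybridGradPsi K η x i - hybridGradPsi K η x' i) = 0 := by
  have hline : ∀ i, HasDerivAt (fun t : ℝ => x i + t * d i) (d i) 0 := fun i => by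
    simpa using ((hasDerivAt_id (0 : ℝ)).mul_const (d i)).const_add (x i)
  have hlog : ∀ i, HasDerivAt (fun t : ℝ => Real.log (x i + t * d i)) (d i / x i) 0 := fun i => by
    simpa using (hline i).log (by simpa using (hx.1 i).ne')
  have hderiv : HasDerivAt (fun t : ℝ => (∑ i, (x i + t * d i) * a i) +
      hybridBreg K η (fun i => x i + t * d i) x')
      ((∑ i, d i * a i) + ((1 / η) * (∑ i, -(d i / x i)) +
        ((K : ℝ) / η) * (∑ i, (d i * Real.log (x i) + x i * (d i / x i))) -
        ∑ i, hybridGradPsi K η x' i * d i)) 0 := by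
    unfold hybridBreg hybridPsi
    simp only [one_div (_ + _), Real.log_inv]
    refine (HasDerivAt.fun_sum fun i _ => (hline i).mul_const (a i)).add
      (((((HasDerivAt.fun_sum fun i _ => (hlog i).neg).const_mul _).add
        ((HasDerivAt.fun_sum fun i _ => ?_).const_mul _)).sub_const _).sub
        (HasDerivAt.fun_sum fun i _ => ((hline i).sub_const _).const_mul _))
    simpa using (hline i).fun_mul (hlog i)
  have hlocal : IsLocalMin (fun t : ℝ => (∑ i, (x i + t * d i) * a i) +
      hybridBreg K η (fun i => x i + t * d i) x') 0 := by
    have hpos : ∀ᶠ t : ℝ in 𝓝 0, ∀ i, 0 < x i + t * d i :=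
      eventually_all.2 fun i =>
        (hline i).continuousAt.eventually (lt_mem_nhds (by simpa using hx.1 i))
    filter_upwards [hpos] with t ht
    simpa using hmin (fun i => x i + t * d i)
      ⟨ht, by rw [sum_add_distrib, ← mul_sum, hd, hx.2]; ring⟩
  rw [← hlocal.hasDerivAt_eq_zero hderiv, mul_sum, mul_sum, ← sum_add_distrib,
    ← sum_sub_distrib, ← sum_add_distrib]
  refine sum_congr rfl fun i _ => ?_
  have := (hx.1 i).ne'
  unfold hybridGradPsi
  field_simp
  ring

/-- Quantitative monotonicity of `t ↦ -1/t + k log t` on the positive reals. -/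
lemma sq_mul_le_sub_mul_sub {k a b : ℝ} (hk : 0 ≤ k) (ha : 0 < a) (hb : 0 < b) :
    (a - b) ^ 2 * (1 / (a * b) + k / max a b) ≤
      (a - b) * ((-(1 / a) + k * Real.log a) - (-(1 / b) + k * Real.log b)) := by
  wlog hab : b ≤ a generalizing a b
  · have := this hb ha (le_of_not_ge hab)
    rw [max_comm, mul_comm b a] at this
    linarith
  rw [max_eq_left hab]
  have hlog : (a - b) / a ≤ Real.log a - Real.log b := by
    have := Real.log_le_sub_one_of_pos (div_pos hb ha)
    rw [Real.log_div hb.ne' ha.ne'] at this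
    rw [sub_div, div_self ha.ne']
    linarith
  have h := mul_le_mul_of_nonneg_left hlog (mul_nonneg (sub_nonneg.2 hab) hk)
  calc (a - b) ^ 2 * (1 / (a * b) + k / a)
      = (a - b) * (1 / b - 1 / a) + (a - b) * k * ((a - b) / a) := by field_simp
    _ ≤ _ := by linarith

/-- If `u = a - b` satisfies the strong-monotonicity inequality against a perturbation `η δ`
which is small relative to `1 / a`, then `u δ` is of second order in `δ`. -/
lemma sub_mul_mul_le {η k a b δ : ℝ} (hη : 0 < η) (hk : 0 ≤ k) (ha : 0 < a) (hb : 0 < b)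
    (hδ : η * (|δ| * a) ≤ 1 / 2)
    (h : (a - b) ^ 2 * (1 / (a * b) + k / max a b) ≤ η * (δ * (a - b))) :
    (a - b) * δ * (1 + k * a) ≤ 2 * η * (|δ| * a) ^ 2 := by
  have hnonneg : 0 ≤ η * |δ| := by positivity
  have habs : |a - b| * (1 / (a * b) + k / max a b) ≤ η * |δ| := by
    rcases eq_or_ne (a - b) 0 with h0 | h0
    · simpa [h0] using hnonneg
    · refine le_of_mul_le_mul_left ?_ (abs_pos.2 h0)
      calc |a - b| * (|a - b| * (1 / (a * b) + k / max a b))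
          = (a - b) ^ 2 * (1 / (a * b) + k / max a b) := by rw [← sq_abs (a - b)]; ring
        _ ≤ η * (δ * (a - b)) := h
        _ ≤ η * |δ * (a - b)| := by gcongr; exact le_abs_self _
        _ = |a - b| * (η * |δ|) := by rw [abs_mul]; ring
  have hfirst : |a - b| * (1 + k * a) ≤ 2 * η * |δ| * a ^ 2 := by
    rcases le_total b a with hab | hab
    · rw [max_eq_left hab] at habs
      have : |a - b| * ((1 + k * a) / a ^ 2) ≤ η * |δ| := by
        refine le_trans ?_ habs
        have : (1 + k * a) / a ^ 2 = 1 / (a * a) + k / a := by field_simp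
        rw [this]
        gcongr
      rw [← mul_div_assoc, div_le_iff₀ (by positivity)] at this
      nlinarith [mul_nonneg hnonneg (sq_nonneg a)]
    · rw [max_eq_right hab] at habs
      have hmul : |a - b| * (1 + k * a) ≤ η * |δ| * (a * b) := by
        have : |a - b| * (1 + k * a) = |a - b| * (1 / (a * b) + k / b) * (a * b) := by
          field_simp
        rw [this]
        gcongr
      have hle : b ≤ 2 * a := by
        have hdist : b - a = |a - b| := by rw [abs_of_nonpos (by linarith)]; ring
        nlinarith [mul_nonneg (abs_nonneg (a - b)) (mul_nonneg hk ha.le),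
          mul_le_mul_of_nonneg_right hδ hb.le]
      nlinarith [mul_le_mul_of_nonneg_left hle (mul_nonneg hnonneg ha.le)]
  calc (a - b) * δ * (1 + k * a)
      ≤ |(a - b) * δ| * (1 + k * a) := by gcongr; exact le_abs_self _
    _ = |a - b| * (1 + k * a) * |δ| := by rw [abs_mul]; ring
    _ ≤ 2 * η * |δ| * a ^ 2 * |δ| := by gcongr
    _ = _ := by ring

/-- **Combined per-round stability bound from the proof of Lemma 3 of the paper.**
For one round of Algorithm 2, the stability term `⟨x − y, ℓ̂ − m⟩` is at most
`4η·min{(ℓⱼ − mⱼ)², (ℓⱼ − mⱼ)²/(K·xⱼ)}`. -/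
theorem omd_per_round_stability
    (K : ℕ) (hK : 2 ≤ K) (η : ℝ) (hη : 0 < η) (hηK : η ≤ 1 / K) (hη' : η ≤ 1 / 162)
    (α : ℝ) (hα : α = 8 * η)
    (x' : Fin K → ℝ) (hx' : posSimplex K x')
    (ℓ m : Fin K → ℝ)
    (hℓ : ∀ i, ℓ i ∈ Set.Icc (0 : ℝ) 1)
    (hm : ∀ i, m i ∈ Set.Icc (0 : ℝ) 1)
    (j : Fin K) (w : Fin K → ℝ) (hw : posSimplex K w)
    (x : Fin K → ℝ) (hx : posSimplex K x)
    (hxmin : ∀ z, posSimplex K z →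
      (∑ i, x i * m i) + hybridBreg K η x x' ≤ (∑ i, z i * m i) + hybridBreg K η z x')
    (hxw : ∀ i, x i ≤ w i / (1 - α))
    (y : Fin K → ℝ) (hy : posSimplex K y)
    (hymin : ∀ z, posSimplex K z →
      (∑ i, y i * iwEstimator K ℓ m j w i) + hybridBreg K η y x' ≤
        (∑ i, z i * iwEstimator K ℓ m j w i) + hybridBreg K η z x') :
    ∑ i, (x i - y i) * (iwEstimator K ℓ m j w i - m i) ≤
      4 * η * min ((ℓ j - m j) ^ 2) ((ℓ j - m j) ^ 2 / ((K : ℝ) * x j)) := by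
  have hest : ∀ i, iwEstimator K ℓ m j w i - m i = if i = j then (ℓ j - m j) / w j else 0 := by
    intro i
    unfold iwEstimator
    split_ifs with h
    · rw [h]; ring
    · ring
  have hwj := hw.1 j
  have hxj := hx.1 j
  have hyj := hy.1 j
  set δ := (ℓ j - m j) / w j with hδ
  have hinner : ∑ i, (x i - y i) * (iwEstimator K ℓ m j w i - m i) = (x j - y j) * δ := by
    simp [hest]
  rw [hinner]
  have hd : ∑ i, (x i - y i) = 0 := by rw [sum_sub_distrib, hx.2, hy.2, sub_self]
  have hfoc : ∑ i, (x i - y i) * ((-(1 / x i) + K * Real.log (x i)) -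
      (-(1 / y i) + K * Real.log (y i))) = η * (δ * (x j - y j)) := by
    have hsub := congrArg₂ (· - ·) (sum_mul_grad_eq_zero_of_min hx hxmin hd)
      (sum_mul_grad_eq_zero_of_min hy hymin hd)
    simp only [← sum_sub_distrib, sub_self] at hsub
    rw [mul_comm δ, ← hinner, mul_sum, ← sub_eq_zero, ← sum_sub_distrib,
      ← mul_zero η, ← hsub, mul_sum]
    refine sum_congr rfl fun i _ => ?_
    unfold hybridGradPsi
    field_simp
    ring
  have hk : (0 : ℝ) ≤ K := K.cast_nonneg
  have hmono : (x j - y j) ^ 2 * (1 / (x j * y j) + K / max (x j) (y j)) ≤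
      η * (δ * (x j - y j)) := by
    rw [← hfoc]
    refine (sq_mul_le_sub_mul_sub hk hxj hyj).trans
      (single_le_sum (f := fun i => (x i - y i) * ((-(1 / x i) + K * Real.log (x i)) -
        (-(1 / y i) + K * Real.log (y i)))) (fun i _ => ?_) (mem_univ j))
    have := hx.1 i
    have := hy.1 i
    exact le_trans (by positivity) (sq_mul_le_sub_mul_sub hk (hx.1 i) (hy.1 i))
  have hratio : x j / w j ≤ 162 / 154 := by
    have h := hxw j
    rw [le_div_iff₀ (by linarith)] at h
    rw [div_le_iff₀ hwj]
    nlinarith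
  have hδx : |δ| * x j = |ℓ j - m j| * (x j / w j) := by
    rw [hδ, abs_div, abs_of_pos hwj]; ring
  have hgap : |ℓ j - m j| ≤ 1 := by
    have := hℓ j
    have := hm j
    simp only [Set.mem_Icc] at *
    exact abs_le.2 ⟨by linarith, by linarith⟩
  have hle : |δ| * x j ≤ |ℓ j - m j| * (162 / 154) := by rw [hδx]; gcongr
  have hmain := sub_mul_mul_le hη hk hxj hyj (by nlinarith) hmono
  have hsq : (|δ| * x j) ^ 2 ≤ 2 * (ℓ j - m j) ^ 2 := by
    calc (|δ| * x j) ^ 2 ≤ (|ℓ j - m j| * (162 / 154)) ^ 2 := by gcongr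
      _ = (162 / 154) ^ 2 * (ℓ j - m j) ^ 2 := by rw [mul_pow, sq_abs]; ring
      _ ≤ _ := by gcongr; norm_num
  have hbound : (x j - y j) * δ * (1 + K * x j) ≤ 4 * η * (ℓ j - m j) ^ 2 := by
    nlinarith [mul_le_mul_of_nonneg_left hsq hη.le]
  have hnonneg : 0 ≤ (x j - y j) * δ := by
    have : 0 ≤ η * (δ * (x j - y j)) := le_trans (by positivity) hmono
    rw [mul_comm]
    exact nonneg_of_mul_nonneg_right this hη
  have hK0 : (0 : ℝ) < K := by exact_mod_cast (by omega : 0 < K)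
  rw [mul_min_of_nonneg _ _ (by positivity), le_min_iff]
  constructor
  · nlinarith [mul_nonneg hnonneg (mul_nonneg hk hxj.le)]
  · rw [← mul_div_assoc (4 * η), le_div_iff₀ (by positivity)]
    linarith
end

section
/- Fix an integer K ≥ 1 and reals α ∈ (0,1) and c' ∈ [0,1]. Let x ∈ Δ_K, j ∈ {1,…,K}, set α' = α(1 − c')/(1 + α(1 − c')) and w = (1 − α')·x + α'·e_j. Then for every ℓ ∈ [0,1]^K: ⟨w − x, ℓ⟩ = α·(1 − c')·(ℓ_j − ⟨w, ℓ⟩), and moreover ⟨w − x, ℓ⟩ ≤ α·(|ℓ_j − c'| + c' − ⟨w, ℓ⟩ − c'² + c'·⟨w, ℓ⟩). -/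
/-- **Per-round deterministic inequality from the proof of Theorem 2 of the paper.**
Biasing the sampling distribution towards arm `j` (whose last observed loss was `c'`)
with fraction `α' = α(1 − c')/(1 + α(1 − c'))` satisfies the stated identity and
inequality for every loss vector `ℓ ∈ [0,1]^K`. -/
theorem biased_distribution_per_round_bound
    (K : ℕ) (hK : 1 ≤ K)
    (α c' : ℝ) (hα0 : 0 < α) (hα1 : α < 1) (hc'0 : 0 ≤ c') (hc'1 : c' ≤ 1)
    (x : Fin K → ℝ) (hx0 : ∀ i, 0 ≤ x i) (hx1 : ∑ i, x i = 1)
    (j : Fin K)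
    (α' : ℝ) (hα' : α' = α * (1 - c') / (1 + α * (1 - c')))
    (w : Fin K → ℝ)
    (hw : w = fun i => (1 - α') * x i + α' * (if i = j then 1 else 0)) :
    ∀ ℓ : Fin K → ℝ, (∀ i, ℓ i ∈ Set.Icc (0 : ℝ) 1) →
      (∑ i, (w i - x i) * ℓ i = α * (1 - c') * (ℓ j - ∑ i, w i * ℓ i)) ∧
      (∑ i, (w i - x i) * ℓ i ≤
        α * (|ℓ j - c'| + c' - (∑ i, w i * ℓ i) - c' ^ 2 + c' * ∑ i, w i * ℓ i)) := by
  intro ℓ _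
  have hW : ∑ i, w i * ℓ i = (1 - α') * ∑ i, x i * ℓ i + α' * ℓ j := by
    simp [hw, add_mul, Finset.sum_add_distrib, Finset.mul_sum, mul_assoc]
  have hd : 0 ≤ α * (1 - c') := mul_nonneg hα0.le (sub_nonneg.2 hc'1)
  have hα'' : α' = α * (1 - c') * (1 - α') := by
    rw [hα']
    field_simp
    ring
  have heq : ∑ i, (w i - x i) * ℓ i = α * (1 - c') * (ℓ j - ∑ i, w i * ℓ i) := by
    simp only [sub_mul, Finset.sum_sub_distrib]
    rw [hW]
    linear_combination (ℓ j - ∑ i, x i * ℓ i) * hα''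
  refine ⟨heq, ?_⟩
  have habs : (1 - c') * (ℓ j - c') ≤ |ℓ j - c'| :=
    (mul_le_mul_of_nonneg_left (le_abs_self _) (sub_nonneg.2 hc'1)).trans
      (mul_le_of_le_one_left (abs_nonneg _) (by linarith))
  rw [heq, mul_assoc]
  refine mul_le_mul_of_nonneg_left ?_ hα0.le
  linarith
end

section
/- Fix integers K ≥ 2 and T ≥ 1 and a real η > 0. Let x₁ ∈ Δ_K be the uniform distribution (x_{1,i} = 1/K for all i), fix i⋆ ∈ {1,…,K}, and let u = (1 − 1/T)·e_{i⋆} + (1/(KT))·𝟙, where e_{i⋆} is the i⋆-th standard basis vector and 𝟙 is the all-ones vector in ℝ^K. Then D_ψ(u, x₁) ≤ (K/η)·ln(KT). -/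
open Finset

theorem hybridPsi_uniform {K : ℕ} (hK : K ≠ 0) (η : ℝ) :
    hybridPsi K η (fun _ => 1 / (K : ℝ)) = 0 := by
  have hK' : (K : ℝ) ≠ 0 := Nat.cast_ne_zero.mpr hK
  simp only [hybridPsi, one_div, inv_inv, Real.log_inv, sum_const, card_univ, Fintype.card_fin,
    nsmul_eq_mul]
  field_simp
  ring

/-- The gradient at the uniform distribution is constant, so the linear term vanishes on
vectors of total mass one. -/
theorem hybridBreg_uniform {K : ℕ} (hK : K ≠ 0) (η : ℝ) {x : Fin K → ℝ} (hx : ∑ i, x i = 1) :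
    hybridBreg K η x (fun _ => 1 / (K : ℝ)) = hybridPsi K η x := by
  have hK' : (K : ℝ) ≠ 0 := Nat.cast_ne_zero.mpr hK
  have hsum : ∑ i, (x i - 1 / (K : ℝ)) = 0 := by
    simp [sum_sub_distrib, hx, hK']
  simp only [hybridBreg, hybridPsi_uniform hK, hybridGradPsi]
  rw [← mul_sum, hsum]
  ring

theorem hybridPsi_le_of_inv_le {K : ℕ} {η M : ℝ} (hη : 0 < η) (hM : 0 < M) {x : Fin K → ℝ}
    (hx : ∀ i, 1 / M ≤ x i) (hsum : ∑ i, x i = 1) :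
    hybridPsi K η x ≤ (K : ℝ) / η * Real.log M := by
  have hpos : ∀ i, 0 < x i := fun i => (one_div_pos.mpr hM).trans_le (hx i)
  have hle : ∀ i, x i ≤ 1 := fun i =>
    hsum ▸ single_le_sum (fun j _ => (hpos j).le) (mem_univ i)
  have hbarrier : ∑ i, Real.log (1 / x i) ≤ K * Real.log M := by
    have h := sum_le_card_nsmul univ (fun i => Real.log (1 / x i)) (Real.log M) fun i _ =>
      Real.log_le_log (one_div_pos.mpr (hpos i)) ((one_div_le hM (hpos i)).mp (hx i))
    simpa using h
  have hentropy : ∑ i, x i * Real.log (x i) ≤ 0 := sum_nonpos fun i _ =>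
    mul_nonpos_of_nonneg_of_nonpos (hpos i).le (Real.log_nonpos (hpos i).le (hle i))
  calc hybridPsi K η x
      ≤ 1 / η * (K * Real.log M) + (K : ℝ) / η * 0 := by
        unfold hybridPsi
        gcongr
    _ = (K : ℝ) / η * Real.log M := by ring

/-- **Initial Bregman divergence bound from the proof of Lemma 3 of the paper.**
With `x₁` the uniform distribution and `u = (1 − 1/T)·e_{i⋆} + (1/(KT))·𝟙`,
`D_ψ(u, x₁) ≤ (K/η)·ln(KT)`. -/
theorem initial_bregman_bound
    (K T : ℕ) (hK : 2 ≤ K) (hT : 1 ≤ T) (η : ℝ) (hη : 0 < η) (istar : Fin K) :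
    hybridBreg K η
        (fun i => (1 - 1 / (T : ℝ)) * (if i = istar then 1 else 0) + 1 / ((K : ℝ) * T))
        (fun _ => 1 / (K : ℝ)) ≤
      ((K : ℝ) / η) * Real.log ((K : ℝ) * T) := by
  have hK0 : K ≠ 0 := by omega
  have hKpos : (0 : ℝ) < K := by positivity
  have hT1 : (1 : ℝ) ≤ T := by exact_mod_cast hT
  have hTpos : (0 : ℝ) < T := by linarith
  have hsum : ∑ i : Fin K,
      ((1 - 1 / (T : ℝ)) * (if i = istar then 1 else 0) + 1 / ((K : ℝ) * T)) = 1 := by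
    rw [sum_add_distrib, ← mul_sum, sum_ite_eq']
    simp only [mem_univ, if_true, sum_const, card_univ, Fintype.card_fin, nsmul_eq_mul]
    field_simp
    ring
  rw [hybridBreg_uniform hK0 η hsum]
  refine hybridPsi_le_of_inv_le hη (mul_pos hKpos hTpos) (fun i => ?_) hsum
  have hT_inv : 1 / (T : ℝ) ≤ 1 := (div_le_one hTpos).mpr hT1
  refine le_add_of_nonneg_left (mul_nonneg (sub_nonneg.mpr hT_inv) ?_)
  split_ifs <;> norm_num
end
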